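/- Let K be a Markov kernel on E, ν a probability measure on E, and consider random weighted particle ensembles: initial particles and weights (ξ_0^i, ω_0^i)_{i=1,…,N_init}, and for each t ≥ 0 post-selection ensembles (ξ̂_t^i, ω̂_t^i)_{i=1,…,N} and post-mutation ensembles (ξ_{t+1}^i, ω_{t+1}^i)_{i=1,…,N}, adapted to σ-algebras F_0 ⊆ F̂_0 ⊆ F_1 ⊆ F̂_1 ⊆ ⋯. Assume: (i) initialization is unbiased, E[Σ_i ω_0^i g(ξ_0^i)] = ∫ g dν for every bounded measurable g; (ii) each selection step is conditionally unbiased, E[Σ_i ω̂_t^i g(ξ̂_t^i) | F_t] = Σ_i ω_t^i g(ξ_t^i) almost surely for every bounded measurable g; (iii) each mutation step moves particles by K, E[Σ_i ω_{t+1}^i g(ξ_{t+1}^i) | F̂_t] = Σ_i ω̂_t^i (Kg)(ξ̂_t^i) almost surely for every bounded measurable g. Then for every time T ≥ 0 and every bounded measurable g, E[Σ_i ω_T^i g(ξ_T^i)] = ∫ K^T g dν = E[g(ξ_T)], where (ξ_t)_{t≥0} is a Markov chain with kernel K and initial distribution ν. -/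

import Mathlib

open MeasureTheory ProbabilityTheory Filter

/-- One-step transition operator of a Markov kernel: `kernelOp K f x = ∫ f(y) K(x, dy)`,
so that `(kernelOp K)^[t] f x = K^t f (x) = E[f(ξ_t) | ξ_0 = x]`. -/
noncomputable def kernelOp {E : Type*} [MeasurableSpace E] (K : Kernel E E) (f : E → ℝ) :
    E → ℝ :=
  fun x => ∫ y, f y ∂(K x)

/-- Theorem 3.1 (weighted ensemble is unbiased): if the initialization is unbiased for `ν`,
each selection step is conditionally unbiased, and each mutation step moves particles by the
Markov kernel `K`, then at every time `T` and for every bounded measurable `g`,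
`E[∑_i ω_T^i g(ξ_T^i)] = ∫ K^T g dν`, which is `E[g(ξ_T)]` for a Markov chain `(ξ_t)` with
kernel `K` and initial distribution `ν`. -/
theorem weighted_ensemble_unbiased
    {E : Type*} [MeasurableSpace E] {Ω : Type*} [mΩ : MeasurableSpace Ω]
    (P : Measure Ω) [IsProbabilityMeasure P]
    (K : Kernel E E) [IsMarkovKernel K] (ν : Measure E) [IsProbabilityMeasure ν]
    (Ninit N : ℕ) (npart : ℕ → ℕ) (hn0 : npart 0 = Ninit) (hnpos : ∀ t, npart (t + 1) = N)
    -- particles and weights before the `t`-th selection step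
    (ξ : (t : ℕ) → Fin (npart t) → Ω → E) (w : (t : ℕ) → Fin (npart t) → Ω → ℝ)
    -- particles and weights after the `t`-th selection step
    (ξh : ℕ → Fin N → Ω → E) (wh : ℕ → Fin N → Ω → ℝ)
    -- the σ-algebras F_t ⊆ F̂_t ⊆ F_{t+1}
    (F Fh : ℕ → MeasurableSpace Ω)
    (hFle : ∀ t, F t ≤ mΩ) (hFhle : ∀ t, Fh t ≤ mΩ)
    (hFFh : ∀ t, F t ≤ Fh t) (hFhF : ∀ t, Fh t ≤ F (t + 1))
    -- integrability of the weighted ensemble averages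
    (hint : ∀ (t : ℕ) (g : E → ℝ), Measurable g → (∃ M, ∀ x, |g x| ≤ M) →
      Integrable (fun ω => ∑ i, w t i ω * g (ξ t i ω)) P)
    (hinth : ∀ (t : ℕ) (g : E → ℝ), Measurable g → (∃ M, ∀ x, |g x| ≤ M) →
      Integrable (fun ω => ∑ i, wh t i ω * g (ξh t i ω)) P)
    -- (i) the initialization is unbiased
    (hinit : ∀ (g : E → ℝ), Measurable g → (∃ M, ∀ x, |g x| ≤ M) →
      ∫ ω, ∑ i, w 0 i ω * g (ξ 0 i ω) ∂P = ∫ x, g x ∂ν)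
    -- (ii) each selection step is conditionally unbiased
    (hsel : ∀ (t : ℕ) (g : E → ℝ), Measurable g → (∃ M, ∀ x, |g x| ≤ M) →
      P[(fun ω => ∑ i, wh t i ω * g (ξh t i ω)) | F t]
        =ᵐ[P] fun ω => ∑ i, w t i ω * g (ξ t i ω))
    -- (iii) each mutation step moves particles by `K`
    (hmut : ∀ (t : ℕ) (g : E → ℝ), Measurable g → (∃ M, ∀ x, |g x| ≤ M) →
      P[(fun ω => ∑ i, w (t + 1) i ω * g (ξ (t + 1) i ω)) | Fh t]
        =ᵐ[P] fun ω => ∑ i, wh t i ω * kernelOp K g (ξh t i ω)) :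
    ∀ (T : ℕ) (g : E → ℝ), Measurable g → (∃ M, ∀ x, |g x| ≤ M) →
      ∫ ω, ∑ i, w T i ω * g (ξ T i ω) ∂P = ∫ x, (kernelOp K)^[T] g x ∂ν := by
  intro T
  induction T with
  | zero => intro g hg hb; simpa using hinit g hg hb
  | succ t ih =>
    intro g hg hb
    have hKm : Measurable (kernelOp K g) :=
      (hg.stronglyMeasurable.integral_kernel (κ := K)).measurable
    have hKb : ∃ M, ∀ x, |kernelOp K g x| ≤ M := by
      obtain ⟨M, hM⟩ := hb
      refine ⟨M, fun x => ?_⟩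
      have h := norm_integral_le_of_norm_le_const (μ := K x) (f := g) (C := M)
        (Eventually.of_forall hM)
      simpa [kernelOp] using h
    rw [Function.iterate_succ_apply, ← ih _ hKm hKb, ← integral_condExp (hFhle t),
      integral_congr_ae (hmut t g hg hb), ← integral_condExp (hFle t),
      integral_congr_ae (hsel t _ hKm hKb)]
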